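/- arXiv:2404.12982 — 4 statements merged into one kernel-verified Lean document; each statement's English description precedes it below -/
import Mathlib

section
/- Let (G_n) be a sequence of bipartite graphs on finite sets (X_n, Y_n), each X_n carrying a probability measure μ_n with deg(x) ≥ 1 for all x ∈ X_n. Let F : ℝ → ℝ≥0 be a continuous bounded function with ∫_ℝ F(x) dx = 1, let f_n : X_n → ℝ and g_n : Y_n → ℝ, and let h, E : ℕ → ℝ>0 with h(n) → 0 and E(n) → 0 as n → ∞. Assume there is a constant C₁ such that for all n and all real a ≤ b, |μ_n({x ∈ X_n : f_n(x) ∈ [a,b]}) − ∫_a^b F(x) dx| ≤ C₁·h(n), and a constant C₂ such that whenever (x,y) ∈ G_n one has |g_n(y) − f_n(x)| ≤ C₂·E(n). Then for every function H : ℕ → ℝ>0 with H(n) → ∞ as n → ∞, one has G_n(μ_n)({y ∈ Y_n : H(n)⁻¹ ≤ |g_n(y)| ≤ H(n)}) → 1 as n → ∞. -/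
open Finset Filter

/-- Under the hypotheses of the lifting lemma (effective equidistribution
of `f_n` with continuous bounded density `F` of total mass 1, and `|g_n(y) − f_n(x)| ≤
C₂·E(n)` along edges, with `h(n) → 0` and `E(n) → 0`), for every `H : ℕ → ℝ_{>0}` with
`H(n) → ∞` the `G_n`-transformed measure of `{y : H(n)⁻¹ ≤ |g_n(y)| ≤ H(n)}` tends to 1. -/
theorem stmt_4 (X Y : ℕ → Type) [∀ n, Fintype (X n)] [∀ n, Fintype (Y n)]
    [∀ n, DecidableEq (X n)] [∀ n, DecidableEq (Y n)]
    (G : ∀ n, Finset (X n × Y n))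
    (μ : ∀ n, X n → ℝ) (hμ0 : ∀ n x, 0 ≤ μ n x) (hμ1 : ∀ n, ∑ x, μ n x = 1)
    (hdeg : ∀ n (x : X n), 1 ≤ (univ.filter fun y => (x, y) ∈ G n).card)
    (F : ℝ → ℝ) (hF0 : ∀ x, 0 ≤ F x) (hFc : Continuous F)
    (M : ℝ) (hFM : ∀ x, F x ≤ M) (hF1 : ∫ t, F t = 1)
    (f : ∀ n, X n → ℝ) (g : ∀ n, Y n → ℝ)
    (h E : ℕ → ℝ) (hh : ∀ n, 0 < h n) (hE : ∀ n, 0 < E n)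
    (hh0 : Tendsto h atTop (nhds 0)) (hE0 : Tendsto E atTop (nhds 0))
    (C₁ : ℝ)
    (hf : ∀ n (a b : ℝ), a ≤ b →
      |(∑ x ∈ univ.filter (fun x => f n x ∈ Set.Icc a b), μ n x) - ∫ t in a..b, F t|
        ≤ C₁ * h n)
    (C₂ : ℝ)
    (hfg : ∀ n (x : X n) (y : Y n), (x, y) ∈ G n → |g n y - f n x| ≤ C₂ * E n)
    (H : ℕ → ℝ) (hH : ∀ n, 0 < H n) (hHtop : Tendsto H atTop atTop) :
    Tendsto (fun n =>
      ∑ y ∈ univ.filter (fun y => (H n)⁻¹ ≤ |g n y| ∧ |g n y| ≤ H n),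
        ∑ x ∈ univ.filter (fun x => (x, y) ∈ G n),
          μ n x / ((univ.filter fun y' => (x, y') ∈ G n).card : ℝ))
      atTop (nhds 1) := by
  set d : ℕ → ℝ := fun n => (H n)⁻¹ + |C₂| * E n with hd
  set R : ℕ → ℝ := fun n => H n - |C₂| * E n with hR
  have hCE : Tendsto (fun n => |C₂| * E n) atTop (nhds 0) := by
    simpa using hE0.const_mul |C₂|
  have hd0 : Tendsto d atTop (nhds 0) := by
    simpa using hHtop.inv_tendsto_atTop.add hCE
  have hRtop : Tendsto R atTop atTop := by
    have := hHtop.atTop_add hCE.neg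
    simpa [hR, sub_eq_add_neg] using this
  have hdpos : ∀ n, 0 ≤ d n := fun n =>
    add_nonneg (inv_nonneg.2 (hH n).le) (mul_nonneg (abs_nonneg _) (hE n).le)
  have hint : MeasureTheory.Integrable F := by
    by_contra hc
    rw [MeasureTheory.integral_undef hc] at hF1
    exact zero_ne_one hF1
  have hI : Tendsto (fun n => ∫ t in (-R n)..(R n), F t) atTop (nhds 1) := by
    rw [← hF1]
    exact MeasureTheory.intervalIntegral_tendsto_integral hint
      (tendsto_neg_atTop_atBot.comp hRtop) hRtop
  have hJ : ∀ n, ∫ t in (-d n)..(d n), F t ≤ M * (2 * d n) := by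
    intro n
    have h1 : ‖∫ t in (-d n)..(d n), F t‖ ≤ M * |d n - -d n| := by
      apply intervalIntegral.norm_integral_le_of_norm_le_const
      intro x _
      rw [Real.norm_eq_abs, abs_of_nonneg (hF0 x)]
      exact hFM x
    have h2 : |d n - -d n| = 2 * d n := by
      rw [abs_of_nonneg] <;> linarith [hdpos n]
    rw [h2] at h1
    exact (le_abs_self _).trans h1
  have hlow : Tendsto (fun n => (∫ t in (-R n)..(R n), F t) - C₁ * h n
      - (M * (2 * d n) + C₁ * h n)) atTop (nhds 1) := by
    have h1 := (hI.sub (hh0.const_mul C₁)).sub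
      (((hd0.const_mul 2).const_mul M).add (hh0.const_mul C₁))
    simpa using h1
  have hswap : ∀ n, (∑ y ∈ univ.filter (fun y => (H n)⁻¹ ≤ |g n y| ∧ |g n y| ≤ H n),
        ∑ x ∈ univ.filter (fun x => (x, y) ∈ G n),
          μ n x / ((univ.filter fun y' => (x, y') ∈ G n).card : ℝ)) =
      ∑ x, ∑ y ∈ univ.filter (fun y => (x, y) ∈ G n ∧ (H n)⁻¹ ≤ |g n y| ∧ |g n y| ≤ H n),
          μ n x / ((univ.filter fun y' => (x, y') ∈ G n).card : ℝ) := by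
    intro n
    apply Finset.sum_comm'
    intro x y
    simp
    tauto
  have hall : ∀ n (x : X n), (∑ y ∈ univ.filter (fun y => (x, y) ∈ G n),
      μ n x / ((univ.filter fun y' => (x, y') ∈ G n).card : ℝ)) = μ n x := by
    intro n x
    rw [Finset.sum_const, nsmul_eq_mul]
    have : ((univ.filter fun y' => (x, y') ∈ G n).card : ℝ) ≠ 0 := by
      have := hdeg n x
      exact_mod_cast (by omega)
    field_simp
  have hnn : ∀ n (x : X n), 0 ≤ μ n x / ((univ.filter fun y' => (x, y') ∈ G n).card : ℝ) :=
    fun n x => div_nonneg (hμ0 n x) (Nat.cast_nonneg _)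
  refine tendsto_of_tendsto_of_tendsto_of_le_of_le' hlow tendsto_const_nhds ?_ ?_
  · filter_upwards [hRtop.eventually_ge_atTop 0] with n hRn
    have h1 := (abs_le.1 (hf n (-R n) (R n) (by linarith))).1
    have h2 := (abs_le.1 (hf n (-d n) (d n) (by linarith [hdpos n]))).2
    have h3 := hJ n
    have key : (∑ x ∈ univ.filter (fun x => f n x ∈ Set.Icc (-R n) (R n)), μ n x)
        - (∑ x ∈ univ.filter (fun x => f n x ∈ Set.Icc (-d n) (d n)), μ n x) ≤
      ∑ x, ∑ y ∈ univ.filter (fun y => (x, y) ∈ G n ∧ (H n)⁻¹ ≤ |g n y| ∧ |g n y| ≤ H n),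
          μ n x / ((univ.filter fun y' => (x, y') ∈ G n).card : ℝ) := by
      rw [Finset.sum_filter, Finset.sum_filter, ← Finset.sum_sub_distrib]
      apply Finset.sum_le_sum
      intro x _
      have hp : 0 ≤ ∑ y ∈ univ.filter
          (fun y => (x, y) ∈ G n ∧ (H n)⁻¹ ≤ |g n y| ∧ |g n y| ≤ H n),
          μ n x / ((univ.filter fun y' => (x, y') ∈ G n).card : ℝ) :=
        Finset.sum_nonneg fun _ _ => hnn n x
      have hm := hμ0 n x
      by_cases hb : f n x ∈ Set.Icc (-d n) (d n)
      · rw [if_pos hb]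
        split_ifs <;> linarith
      rw [if_neg hb]
      by_cases ha : f n x ∈ Set.Icc (-R n) (R n)
      · rw [if_pos ha, sub_zero]
        have : univ.filter
            (fun y => (x, y) ∈ G n ∧ (H n)⁻¹ ≤ |g n y| ∧ |g n y| ≤ H n) =
            univ.filter (fun y => (x, y) ∈ G n) := by
          apply Finset.filter_congr
          intro y _
          refine ⟨fun h => h.1, fun hxy => ⟨hxy, ?_⟩⟩
          have e1 := hfg n x y hxy
          have e2 : C₂ * E n ≤ |C₂| * E n :=
            mul_le_mul_of_nonneg_right (le_abs_self _) (hE n).le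
          have e3 : |f n x| ≤ R n := abs_le.2 ha
          have e4 : d n < |f n x| := by
            by_contra hc
            exact hb (abs_le.1 (not_lt.1 hc))
          have e5 := abs_sub_abs_le_abs_sub (g n y) (f n x)
          have e6 := abs_sub_abs_le_abs_sub (f n x) (g n y)
          rw [abs_sub_comm] at e6
          simp only [hd, hR] at e3 e4
          constructor <;> linarith
        rw [this, hall]
      · rw [if_neg ha]
        linarith
    rw [hswap]
    linarith
  · refine Eventually.of_forall fun n => ?_
    rw [hswap, ← hμ1 n]
    apply Finset.sum_le_sum
    intro x _
    refine le_trans ?_ (hall n x).le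
    apply Finset.sum_le_sum_of_subset_of_nonneg
    · intro y
      simp
      tauto
    · intro _ _ _
      exact hnn n x
end

section
/- Let r, T be real numbers with 0 < T and 2T ≤ r. Then 2·log(r + √(r²−T²)) − 2·log T − 2·log(r + √(r²−4T²)) + 2·log(2T) ≤ 2·log(2+√3). (This is the length of the intersection of the geodesic semicircle |z| = r with the horizontal strip {T ≤ Im z ≤ 2T} in the case r ≥ 2T.) -/
/-- For `0 < T` and `2T ≤ r`, the hyperbolic length of the intersection
of the geodesic semicircle `|z| = r` with the strip `{T ≤ Im z ≤ 2T}`, namely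
`2·log(r + √(r²−T²)) − 2·log T − 2·log(r + √(r²−4T²)) + 2·log(2T)`, is at most
`2·log(2 + √3)`. -/
theorem stmt_8 (r T : ℝ) (hT : 0 < T) (hr : 2 * T ≤ r) :
    2 * Real.log (r + Real.sqrt (r ^ 2 - T ^ 2)) - 2 * Real.log T
        - 2 * Real.log (r + Real.sqrt (r ^ 2 - 4 * T ^ 2)) + 2 * Real.log (2 * T)
      ≤ 2 * Real.log (2 + Real.sqrt 3) := by
  have h3 : Real.sqrt 3 ^ 2 = 3 := Real.sq_sqrt (by norm_num)
  have h3p : 0 ≤ Real.sqrt 3 := Real.sqrt_nonneg 3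
  have hrp : 0 < r := by linarith
  have ha : Real.sqrt (r ^ 2 - T ^ 2) ^ 2 = r ^ 2 - T ^ 2 := Real.sq_sqrt (by nlinarith)
  have hb : Real.sqrt (r ^ 2 - 4 * T ^ 2) ^ 2 = r ^ 2 - 4 * T ^ 2 :=
    Real.sq_sqrt (by nlinarith)
  have hap := Real.sqrt_nonneg (r ^ 2 - T ^ 2)
  have hbp := Real.sqrt_nonneg (r ^ 2 - 4 * T ^ 2)
  generalize Real.sqrt (r ^ 2 - T ^ 2) = a at *
  generalize Real.sqrt (r ^ 2 - 4 * T ^ 2) = b at *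
  generalize Real.sqrt 3 = s at *
  have hsb : 0 ≤ s * b := mul_nonneg h3p hbp
  have hsr : 0 ≤ s * r := mul_nonneg h3p hrp.le
  have key : 2 * a ≤ s * r + b := by
    refine (abs_le_of_sq_le_sq' ?_ (by positivity)).2
    have h1 : 0 ≤ s * r * b := mul_nonneg hsr hbp
    have h2 : (s * r + b) ^ 2 = 3 * r ^ 2 + b ^ 2 + 2 * (s * r * b) := by
      rw [← h3]; ring
    nlinarith
  have hle : 2 * (r + a) ≤ (2 + s) * (r + b) := by nlinarith
  have hlog := Real.log_le_log (by positivity) hle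
  rw [Real.log_mul (by norm_num) (by positivity),
    Real.log_mul (by positivity) (by positivity)] at hlog
  rw [Real.log_mul (by norm_num) hT.ne']
  linarith
end

section
/- Let T > 0 be a real number. The function r ↦ log(r + √(r²−T²)) − log(r + √(r²−4T²)) is antitone (non-increasing) on the interval [2T, ∞). -/
/-- For fixed `T > 0`, the function
`r ↦ log(r + √(r²−T²)) − log(r + √(r²−4T²))` is antitone (non-increasing) on `[2T, ∞)`. -/
theorem stmt_9 (T : ℝ) (hT : 0 < T) :
    AntitoneOn
      (fun r : ℝ => Real.log (r + Real.sqrt (r ^ 2 - T ^ 2))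
        - Real.log (r + Real.sqrt (r ^ 2 - 4 * T ^ 2)))
      (Set.Ici (2 * T)) := by
  intro a ha b hb hab
  simp only [Set.mem_Ici] at ha hb
  have hT2 : 0 < T ^ 2 := by positivity
  have ha4 : 4 * T ^ 2 ≤ a ^ 2 := by nlinarith
  have hab2 : a ^ 2 ≤ b ^ 2 := by nlinarith
  have a1 := Real.sq_sqrt (show 0 ≤ a ^ 2 - T ^ 2 by linarith)
  have a2 := Real.sq_sqrt (show 0 ≤ a ^ 2 - 4 * T ^ 2 by linarith)
  have b1 := Real.sq_sqrt (show 0 ≤ b ^ 2 - T ^ 2 by linarith)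
  have b2 := Real.sq_sqrt (show 0 ≤ b ^ 2 - 4 * T ^ 2 by linarith)
  have h1 : Real.sqrt (a ^ 2 - T ^ 2) ≤ Real.sqrt (b ^ 2 - T ^ 2) :=
    Real.sqrt_le_sqrt (by linarith)
  have h2 : Real.sqrt (a ^ 2 - 4 * T ^ 2) ≤ Real.sqrt (b ^ 2 - 4 * T ^ 2) :=
    Real.sqrt_le_sqrt (by linarith)
  have h3 : Real.sqrt (a ^ 2 - 4 * T ^ 2) ≤ Real.sqrt (a ^ 2 - T ^ 2) :=
    Real.sqrt_le_sqrt (by linarith)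
  have p1 : 0 < Real.sqrt (a ^ 2 - T ^ 2) := Real.sqrt_pos.2 (by linarith)
  have p2 := Real.sqrt_nonneg (a ^ 2 - 4 * T ^ 2)
  have q2 := Real.sqrt_nonneg (b ^ 2 - 4 * T ^ 2)
  have hm : Real.sqrt (b ^ 2 - T ^ 2) * Real.sqrt (a ^ 2 - 4 * T ^ 2)
      ≤ Real.sqrt (a ^ 2 - T ^ 2) * Real.sqrt (b ^ 2 - 4 * T ^ 2) := by
    rw [← Real.sqrt_mul (by linarith), ← Real.sqrt_mul (by linarith)]
    apply Real.sqrt_le_sqrt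
    nlinarith
  show Real.log (b + _) - Real.log (b + _) ≤ Real.log (a + _) - Real.log (a + _)
  generalize Real.sqrt (a ^ 2 - T ^ 2) = A1 at *
  generalize Real.sqrt (a ^ 2 - 4 * T ^ 2) = A2 at *
  generalize Real.sqrt (b ^ 2 - T ^ 2) = B1 at *
  generalize Real.sqrt (b ^ 2 - 4 * T ^ 2) = B2 at *
  have hd : B1 - B2 ≤ A1 - A2 := by
    have hs : 0 < B1 + B2 := by linarith
    refine le_of_mul_le_mul_right ?_ hs
    have := mul_le_mul_of_nonneg_left (show A1 + A2 ≤ B1 + B2 by linarith)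
      (show 0 ≤ A1 - A2 by linarith)
    nlinarith
  have hk : a * (B1 - B2) ≤ b * (A1 - A2) := by
    calc a * (B1 - B2) ≤ a * (A1 - A2) := mul_le_mul_of_nonneg_left hd (by linarith)
      _ ≤ b * (A1 - A2) := mul_le_mul_of_nonneg_right hab (by linarith)
  have key : (b + B1) * (a + A2) ≤ (a + A1) * (b + B2) := by nlinarith
  have l := Real.log_le_log (mul_pos (by linarith) (by linarith)) key
  rw [Real.log_mul (by linarith) (by linarith), Real.log_mul (by linarith) (by linarith)] at l
  linarith
end

section
/- Let Γ be a subgroup of SL(2,ℤ), let f be a cusp form of weight 2 for Γ, and for z₀, z₁ ∈ ℍ let I(z₀,z₁) := ∫_0^1 f((1−t)z₀ + t·z₁)·(z₁−z₀) dt. Fix z ∈ ℍ and define ⟨γ, f⟩ := I(z, γ·z) for γ ∈ Γ. Then ⟨·, f⟩ : Γ → ℂ is additive: for all γ₁, γ₂ ∈ Γ, ⟨γ₁γ₂, f⟩ = ⟨γ₁, f⟩ + ⟨γ₂, f⟩. -/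
open scoped MatrixGroups UpperHalfPlane

/-- The integral `∫_0^1 f((1−t)z₀ + t z₁)·(z₁ − z₀) dt` of the 1-form `f(w) dw` along the
straight segment from `z₀` to `z₁` in the upper half-plane (which lies in `ℍ` by
convexity; the junk value `0` outside `ℍ` is never used for `t ∈ [0,1]`). -/
noncomputable def segIntegral (f : ℍ → ℂ) (z₀ z₁ : ℍ) : ℂ :=
  ∫ t in (0 : ℝ)..1,
    if h : 0 < ((1 - (t : ℂ)) * (z₀ : ℂ) + (t : ℂ) * (z₁ : ℂ)).im then
      f ⟨(1 - (t : ℂ)) * (z₀ : ℂ) + (t : ℂ) * (z₁ : ℂ), h⟩ * ((z₁ : ℂ) - (z₀ : ℂ))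
    else 0

theorem segIntegral_eq_sub (f : ℍ → ℂ) (F : ℂ → ℂ)
    (hc : ContinuousOn (f ∘ UpperHalfPlane.ofComplex) {z : ℂ | 0 < z.im})
    (hF : ∀ w : ℂ, 0 < w.im → HasDerivAt F ((f ∘ UpperHalfPlane.ofComplex) w) w)
    (z₀ z₁ : ℍ) : segIntegral f z₀ z₁ = F z₁ - F z₀ := by
  have him : ∀ t ∈ Set.uIcc (0 : ℝ) 1,
      0 < ((1 - (t : ℂ)) * (z₀ : ℂ) + (t : ℂ) * (z₁ : ℂ)).im := by
    intro t ht
    rw [Set.uIcc_of_le zero_le_one] at ht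
    have h0 := z₀.im_pos
    have h1 := z₁.im_pos
    have e : ((1 - (t : ℂ)) * (z₀ : ℂ) + (t : ℂ) * (z₁ : ℂ)).im
        = (1 - t) * z₀.im + t * z₁.im := by simp
    rw [e]
    rcases ht.1.eq_or_lt with h | h
    · subst h; simpa using h0
    · have : 0 ≤ (1 - t) * z₀.im := mul_nonneg (by linarith [ht.2]) h0.le
      have := mul_pos h h1
      linarith
  have key : segIntegral f z₀ z₁ = ∫ t in (0 : ℝ)..1,
      (f ∘ UpperHalfPlane.ofComplex) ((1 - (t : ℂ)) * (z₀ : ℂ) + (t : ℂ) * (z₁ : ℂ))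
        * ((z₁ : ℂ) - (z₀ : ℂ)) := by
    unfold segIntegral
    refine intervalIntegral.integral_congr fun t ht => ?_
    have h := him t ht
    simp only [dif_pos h, Function.comp_apply, UpperHalfPlane.ofComplex_apply_of_im_pos h]
  have hcl : Continuous fun t : ℝ => (1 - (t : ℂ)) * (z₀ : ℂ) + (t : ℂ) * (z₁ : ℂ) := by
    fun_prop
  rw [key, intervalIntegral.integral_eq_sub_of_hasDerivAt
    (f := fun t : ℝ => F ((1 - (t : ℂ)) * (z₀ : ℂ) + (t : ℂ) * (z₁ : ℂ)))]
  · simp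
  · intro t ht
    have hl : HasDerivAt (fun t : ℝ => (1 - (t : ℂ)) * (z₀ : ℂ) + (t : ℂ) * (z₁ : ℂ))
        ((z₁ : ℂ) - (z₀ : ℂ)) t := by
      have h1 : HasDerivAt (fun t : ℝ => (t : ℂ)) 1 t := Complex.ofRealCLM.hasDerivAt
      refine (((h1.const_sub 1).mul_const (z₀ : ℂ)).add (h1.mul_const (z₁ : ℂ))).congr_deriv ?_
      ring
    exact (hF _ (him t ht)).comp t hl
  · apply ContinuousOn.intervalIntegrable
    exact (hc.comp hcl.continuousOn him).mul continuousOn_const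

theorem primitive_smul_sub (Γ : Subgroup SL(2, ℤ)) (f : CuspForm Γ 2) (F : ℂ → ℂ)
    (hF : ∀ w : ℂ, 0 < w.im → HasDerivAt F ((f ∘ UpperHalfPlane.ofComplex) w) w)
    (γ : SL(2, ℤ)) (hγ : γ ∈ Γ) (z w : ℍ) :
    F (γ • z : ℍ) - F z = F (γ • w : ℍ) - F w := by
  let G : ℂ → ℂ := fun u => ((γ 0 0 : ℂ) * u + γ 0 1) / ((γ 1 0 : ℂ) * u + γ 1 1)
  have hG : ∀ u : ℍ, G u = (γ • u : ℍ) := by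
    intro u
    rw [UpperHalfPlane.coe_specialLinearGroup_apply]
    simp [G]
  have hden : ∀ u : ℍ, UpperHalfPlane.denom (γ : GL (Fin 2) ℝ) u = (γ 1 0 : ℂ) * u + γ 1 1 := by
    intro u
    simp [UpperHalfPlane.denom]
  have hne : ∀ u : ℍ, (γ 1 0 : ℂ) * u + γ 1 1 ≠ 0 := fun u => by
    rw [← hden]; exact UpperHalfPlane.denom_ne_zero _ u
  have hdet : (γ 0 0 : ℂ) * γ 1 1 - γ 0 1 * γ 1 0 = 1 := by
    have := γ.det_coe
    rw [Matrix.det_fin_two] at this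
    exact_mod_cast this
  have hd : ∀ u : ℂ, 0 < u.im → HasDerivAt (fun u => F (G u) - F u) 0 u := by
    intro u hu
    obtain ⟨u, rfl⟩ : ∃ v : ℍ, (v : ℂ) = u := ⟨⟨u, hu⟩, rfl⟩
    have hGd : HasDerivAt G (1 / ((γ 1 0 : ℂ) * u + γ 1 1) ^ 2) (u : ℂ) := by
      have h1 := (((hasDerivAt_id (u : ℂ)).const_mul (γ 0 0 : ℂ)).add_const (γ 0 1 : ℂ)).div
        (((hasDerivAt_id (u : ℂ)).const_mul (γ 1 0 : ℂ)).add_const (γ 1 1 : ℂ)) (hne u)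
      refine h1.congr_deriv ?_
      simp only [id]
      congr 1
      linear_combination hdet
    have hFG : HasDerivAt F (f (γ • u)) (G u) := by
      rw [hG]
      simpa using hF (γ • u : ℍ) (γ • u).im_pos
    have h2 := (hFG.comp (u : ℂ) hGd).sub (hF u hu)
    refine h2.congr_deriv ?_
    have h3 := SlashInvariantForm.slash_action_eqn_SL'' f hγ u
    rw [h3, hden]
    have := hne u
    simp only [Function.comp_apply, UpperHalfPlane.ofComplex_apply]
    rw [zpow_ofNat]
    field_simp
    simp
  have hU : Convex ℝ {z : ℂ | 0 < z.im} := convex_halfSpace_im_gt 0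
  have := UpperHalfPlane.isOpen_upperHalfPlaneSet.is_const_of_deriv_eq_zero
    (f := fun u => F (G u) - F u) hU.isPreconnected
    (fun u hu => (hd u hu).differentiableAt.differentiableWithinAt)
    (fun u hu => (hd u hu).deriv) z.im_pos w.im_pos
  simpa only [hG] using this

/-- For a cusp form `f` of weight 2 for `Γ ≤ SL(2,ℤ)`, a fixed base
point `z ∈ ℍ`, and the modular symbol `⟨γ, f⟩ := I(z, γ·z)` (segment integral of
`f(w) dw`), the map `⟨·, f⟩ : Γ → ℂ` is additive:
`⟨γ₁γ₂, f⟩ = ⟨γ₁, f⟩ + ⟨γ₂, f⟩`. -/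
theorem stmt_18 (Γ : Subgroup SL(2, ℤ)) (f : CuspForm Γ 2) (z : ℍ) (γ₁ γ₂ : Γ) :
    segIntegral f z (((γ₁ * γ₂ : Γ) : SL(2, ℤ)) • z)
      = segIntegral f z ((γ₁ : SL(2, ℤ)) • z) + segIntegral f z ((γ₂ : SL(2, ℤ)) • z) := by
  have hol : DifferentiableOn ℂ (f ∘ UpperHalfPlane.ofComplex) {z : ℂ | 0 < z.im} :=
    UpperHalfPlane.mdifferentiable_iff.mp f.holo'
  obtain ⟨F, hF'⟩ := (convex_halfSpace_im_gt 0).exists_forall_hasDerivWithinAt hol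
  have hF : ∀ w : ℂ, 0 < w.im → HasDerivAt F ((f ∘ UpperHalfPlane.ofComplex) w) w :=
    fun w hw => (hF' w hw).hasDerivAt (UpperHalfPlane.isOpen_upperHalfPlaneSet.mem_nhds hw)
  simp only [segIntegral_eq_sub f F hol.continuousOn hF]
  have h := primitive_smul_sub Γ f F hF γ₁ γ₁.2 z ((γ₂ : SL(2, ℤ)) • z)
  rw [Subgroup.coe_mul, mul_smul]
  linear_combination -h
end
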